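/- arXiv:1905.11306 — 2 statements merged into one kernel-verified Lean document; each statement's English description precedes it below -/
import Mathlib

section
/- Let X be a projective variety over ℂ not isomorphic to projective space. Then any morphism X → ℙⁿ with n = dim X that is injective on points cannot exist; equivalently, every injective morphism X → ℙ^s satisfies s ≥ dim X + 1. -/
open AlgebraicGeometry CategoryTheory MvPolynomial

attribute [local instance] MvPolynomial.gradedAlgebra

/-- Projective `n`-space over `ℂ` as a scheme. -/
noncomputable def ProjSpace (n : ℕ) : Scheme :=
  Proj (homogeneousSubmodule (Fin (n + 1)) ℂ)

/-- The structure morphism `ℙⁿ_ℂ ⟶ Spec ℂ`. -/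
noncomputable def ProjSpace.structMor (n : ℕ) :
    ProjSpace n ⟶ Spec (CommRingCat.of ℂ) :=
  Proj.toSpecZero (homogeneousSubmodule (Fin (n + 1)) ℂ) ≫
    Spec.map (CommRingCat.ofHom
      ((GradedRing.projZeroRingHom' (homogeneousSubmodule (Fin (n + 1)) ℂ)).comp
        (C : ℂ →+* MvPolynomial (Fin (n + 1)) ℂ)))

open Polynomial in
/-- Over an integrally closed domain `R`, if `f r` is a root of the image under `f : R →+* K` of
the minimal polynomial of an integral element `s`, then some prime over `ker f` contains
`s - r`. -/
theorem exists_prime_over_ker_of_root_minpoly {R S K : Type*} [CommRing R] [IsDomain R]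
    [IsIntegrallyClosed R] [CommRing S] [IsDomain S] [Algebra R S] [FaithfulSMul R S]
    [Algebra.IsIntegral R S] [Field K] (f : R →+* K) (s : S) (r : R)
    (hr : ((minpoly R s).map f).IsRoot (f r)) :
    ∃ Q : PrimeSpectrum S, Q.asIdeal.comap (algebraMap R S) = RingHom.ker f ∧
      s - algebraMap R S r ∈ Q.asIdeal := by
  have hs : IsIntegral R s := Algebra.IsIntegral.isIntegral s
  let B := Algebra.adjoin R {s}
  have : Algebra.IsIntegral B S := Algebra.IsIntegral.tower_top (R := R)
  let g : B →+* K := (AdjoinRoot.lift f (f r) (by rwa [IsRoot, Polynomial.eval_map] at hr)).comp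
    (minpoly.equivAdjoin hs).symm.toRingEquiv.toRingHom
  have hg : ∀ x : R, g (algebraMap R B x) = f x := fun x ↦ by simp [g]
  have hgs : g ⟨s, Algebra.self_mem_adjoin_singleton R s⟩ = f r := by
    have : (minpoly.equivAdjoin hs).symm ⟨s, Algebra.self_mem_adjoin_singleton R s⟩ =
        AdjoinRoot.root (minpoly R s) := by
      rw [AlgEquiv.symm_apply_eq]
      ext
      simp [minpoly.coe_equivAdjoin]
    simp [g, this]
  have := RingHom.ker_isPrime g
  obtain ⟨Q, -, hQ, hQg⟩ := Ideal.exists_ideal_over_prime_of_isIntegral (S := S) (RingHom.ker g) ⊥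
    (by rw [← RingHom.ker_eq_comap_bot, (RingHom.injective_iff_ker_eq_bot _).mp
      (FaithfulSMul.algebraMap_injective B S)]; exact bot_le)
  refine ⟨⟨Q, hQ⟩, ?_, ?_⟩
  · ext x
    rw [Ideal.mem_comap, IsScalarTower.algebraMap_apply R B S, ← Ideal.mem_comap, hQg,
      RingHom.mem_ker, RingHom.mem_ker, hg]
  · have : (⟨s, Algebra.self_mem_adjoin_singleton R s⟩ - algebraMap R B r : B) ∈
        Q.comap (algebraMap B S) := by
      rw [hQg, RingHom.mem_ker, map_sub, hg, hgs, sub_self]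
    simpa using this

open Polynomial in
/-- A domain `S` that is integral over a polynomial ring `R` over an algebraically closed field of
characteristic zero and for which `Spec S → Spec R` is injective is equal to `R`. -/
theorem MvPolynomial.bijective_algebraMap_of_comap_injective {σ K S : Type*}
    [Field K] [IsAlgClosed K] [CharZero K] [CommRing S] [IsDomain S] [Algebra (MvPolynomial σ K) S]
    [FaithfulSMul (MvPolynomial σ K) S] [Algebra.IsIntegral (MvPolynomial σ K) S]
    (h : Function.Injective (PrimeSpectrum.comap (algebraMap (MvPolynomial σ K) S))) :
    Function.Bijective (algebraMap (MvPolynomial σ K) S) := by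
  classical
  refine ⟨FaithfulSMul.algebraMap_injective _ S, fun s ↦ ?_⟩
  set R := MvPolynomial σ K
  have hs : IsIntegral R s := Algebra.IsIntegral.isIntegral s
  set p : R[X] := minpoly R s with hp
  have hirr : Irreducible p := (minpoly.prime_of_isIntegrallyClosed hs).irreducible
  have hmon : p.Monic := minpoly.monic hs
  have hdeg : p.natDegree ≠ 0 := fun h0 ↦
    hirr.not_isUnit (by rw [hmon.natDegree_eq_zero.mp h0]; exact isUnit_one)
  let φ := algebraMap R (FractionRing R)
  have hφ : Function.Injective φ := IsFractionRing.injective R (FractionRing R)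
  have hres : p.resultant (derivative p) ≠ 0 := by
    have hirrF : Irreducible (p.map φ) :=
      (Polynomial.Monic.irreducible_iff_irreducible_map_fraction_map hmon).mp hirr
    have hcop : IsCoprime (p.map φ) (derivative (p.map φ)) := hirrF.separable
    have hne := resultant_ne_zero _ _ hcop
    rw [derivative_map, natDegree_map_eq_of_injective hφ, natDegree_map_eq_of_injective hφ,
      resultant_map_map] at hne
    exact fun h0 ↦ hne (by rw [h0, map_zero])
  obtain ⟨v, hv⟩ : ∃ v : σ → K, MvPolynomial.eval v (p.resultant (derivative p)) ≠ 0 := by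
    by_contra! H
    exact hres (MvPolynomial.funext fun v ↦ by simpa using H v)
  obtain ⟨a, b, -, -, hab⟩ := exists_mul_add_mul_eq_C_resultant p (derivative p) le_rfl le_rfl
    (Or.inl hdeg)
  set f : R →+* K := MvPolynomial.eval v
  have hsep : (p.map f).Separable := by
    have := congrArg (Polynomial.map f) hab
    rw [Polynomial.map_add, Polynomial.map_mul, Polynomial.map_mul, ← derivative_map,
      Polynomial.map_C] at this
    refine ⟨Polynomial.C (f (p.resultant (derivative p)))⁻¹ * a.map f,
      Polynomial.C (f (p.resultant (derivative p)))⁻¹ * b.map f, ?_⟩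
    rw [mul_assoc, mul_assoc, ← mul_add, mul_comm (a.map f), mul_comm (b.map f), this,
      ← Polynomial.C_mul, inv_mul_cancel₀ hv, Polynomial.C_1]
  by_cases h1 : p.natDegree = 1
  · have hps : Polynomial.aeval s p = 0 := minpoly.aeval R s
    rw [hmon.eq_X_add_C h1, map_add, Polynomial.aeval_X, Polynomial.aeval_C] at hps
    exact ⟨-p.coeff 0, by rw [map_neg, eq_comm, ← add_eq_zero_iff_eq_neg, hps]⟩
  have hcard : (p.map f).roots.toFinset.card = p.natDegree := by
    rw [Multiset.toFinset_card_of_nodup (nodup_roots hsep),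
      ← (IsAlgClosed.splits (p.map f)).natDegree_eq_card_roots, hmon.natDegree_map]
  obtain ⟨α, hα, β, hβ, hαβ⟩ := Finset.one_lt_card.mp
    (show 1 < (p.map f).roots.toFinset.card by omega)
  have root : ∀ γ ∈ (p.map f).roots.toFinset, (p.map f).IsRoot (f (MvPolynomial.C γ)) := by
    intro γ hγ
    rw [MvPolynomial.eval_C]
    exact isRoot_of_mem_roots (Multiset.mem_toFinset.mp hγ)
  obtain ⟨P, hP, hPs⟩ := exists_prime_over_ker_of_root_minpoly f s _ (root α hα)
  obtain ⟨Q, hQ, hQs⟩ := exists_prime_over_ker_of_root_minpoly f s _ (root β hβ)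
  obtain rfl : P = Q := h (PrimeSpectrum.ext (hP.trans hQ.symm))
  have hmem : (algebraMap R S) (MvPolynomial.C (α - β)) ∈ P.asIdeal := by
    have := P.asIdeal.sub_mem hQs hPs
    rwa [sub_sub_sub_cancel_left, ← map_sub, ← map_sub] at this
  refine absurd (Ideal.eq_top_of_isUnit_mem _ hmem ?_) P.isPrime.ne_top
  exact ((sub_ne_zero.mpr hαβ).isUnit.map MvPolynomial.C).map _

/-- Scaling all values by `c` scales the value of a form of degree `n` by `c ^ n`. -/
theorem MvPolynomial.IsHomogeneous.eval₂_mul_right {σ R S : Type*} [CommSemiring R]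
    [CommSemiring S] {p : MvPolynomial σ R} {n : ℕ} (hp : p.IsHomogeneous n) (f : R →+* S)
    (g : σ → S) (c : S) :
    MvPolynomial.eval₂ f (fun j ↦ g j * c) p = MvPolynomial.eval₂ f g p * c ^ n := by
  rw [MvPolynomial.eval₂_eq, MvPolynomial.eval₂_eq, Finset.sum_mul]
  refine Finset.sum_congr rfl fun d hd ↦ ?_
  have : ∑ i ∈ d.support, d i = n := by
    simpa [Finsupp.weight_apply, Finsupp.sum] using hp (mem_support_iff.mp hd)
  simp only [mul_pow, Finset.prod_mul_distrib, Finset.prod_pow_eq_pow_sum, this, mul_assoc]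

section

variable (R : Type*) [CommRing R] {σ : Type*} [DecidableEq σ] (i : σ)

/-- Setting the variable `X i` equal to `1`. -/
noncomputable def MvPolynomial.dehomogenize : MvPolynomial σ R →ₐ[R] MvPolynomial {j // j ≠ i} R :=
  aeval fun j ↦ if h : j = i then 1 else X ⟨j, h⟩

/-- The map from the degree zero part of `R[X][1 / X i]` given by setting `X i` equal to `1`. -/
noncomputable def MvPolynomial.awayToMvPolynomial :
    HomogeneousLocalization.Away (homogeneousSubmodule σ R) (X i) →+*
      MvPolynomial {j // j ≠ i} R :=
  (Localization.awayLift (dehomogenize R i).toRingHom (X i) (by simp [dehomogenize])).comp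
    (algebraMap _ _)

theorem MvPolynomial.awayToMvPolynomial_mk (hX : X i ∈ homogeneousSubmodule σ R 1) (n : ℕ)
    (a : MvPolynomial σ R) (ha : a ∈ homogeneousSubmodule σ R (n • 1)) :
    awayToMvPolynomial R i (.mk _ hX n a ha) = dehomogenize R i a := by
  simp only [awayToMvPolynomial, RingHom.comp_apply, HomogeneousLocalization.algebraMap_apply,
    HomogeneousLocalization.Away.val_mk]
  have h1 : (dehomogenize R i).toRingHom (X i) * 1 = 1 := by simp [dehomogenize]
  rw [Localization.awayLift_mk (dehomogenize R i).toRingHom (X i) a 1 h1]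
  simp

theorem MvPolynomial.awayToMvPolynomial_bijective :
    Function.Bijective (awayToMvPolynomial R i) := by
  have hX : X i ∈ homogeneousSubmodule σ R 1 := isHomogeneous_X R i
  constructor
  · let c : Localization.Away (X i : MvPolynomial σ R) :=
      Localization.mk 1 ⟨X i, Submonoid.mem_powers _⟩
    let alg := algebraMap (MvPolynomial σ R) (Localization.Away (X i : MvPolynomial σ R))
    have hc : alg (X i) * c = 1 := by
      rw [← Localization.mk_one_eq_algebraMap, Localization.mk_mul, one_mul, mul_one]
      exact Localization.mk_self (⟨X i, _⟩ : Submonoid.powers (X i : MvPolynomial σ R))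
    let E : MvPolynomial {j // j ≠ i} R →+* Localization.Away (X i : MvPolynomial σ R) :=
      eval₂Hom (alg.comp C) fun j ↦ alg (X j.1) * c
    have hE (p : MvPolynomial σ R) :
        E (dehomogenize R i p) = eval₂ (alg.comp C) (fun j ↦ alg (X j) * c) p := by
      refine DFunLike.congr_fun (f := E.comp (dehomogenize R i).toRingHom)
        (g := eval₂Hom (alg.comp C) (fun j ↦ alg (X j) * c)) (ringHom_ext (fun r ↦ ?_) fun j ↦ ?_) p
      · simp [E, dehomogenize, algebraMap_eq]
      · by_cases h : j = i
        · subst h; simp [E, dehomogenize, hc]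
        · simp [E, dehomogenize, h]
    have key : ∀ z, E (awayToMvPolynomial R i z) = z.val := by
      intro z
      obtain ⟨n, a, ha, rfl⟩ := HomogeneousLocalization.Away.mk_surjective _ hX z
      rw [awayToMvPolynomial_mk, hE, IsHomogeneous.eval₂_mul_right (n := n) (by simpa using ha),
        HomogeneousLocalization.Away.val_mk]
      have : eval₂ (alg.comp C) (fun j ↦ alg (X j)) a = alg a :=
        DFunLike.congr_fun (f := eval₂Hom (alg.comp C) (fun j ↦ alg (X j))) (g := alg)
          (ringHom_ext (fun r ↦ by simp) fun j ↦ by simp) a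
      rw [this, ← Localization.mk_one_eq_algebraMap, Localization.mk_pow, Localization.mk_mul]
      simp
    exact fun a b hab ↦ HomogeneousLocalization.val_injective _ (by rw [← key, ← key, hab])
  · intro p
    change p ∈ (awayToMvPolynomial R i).range
    induction p using MvPolynomial.induction_on with
    | C r =>
      refine ⟨.mk _ hX 0 (C r) (by simp), ?_⟩
      rw [awayToMvPolynomial_mk]
      simp [dehomogenize, algebraMap_eq]
    | add p q hp hq => exact add_mem hp hq
    | mul_X p j hp =>
      refine mul_mem hp ⟨.mk _ hX 1 (X j) (by simpa using isHomogeneous_X _ _), ?_⟩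
      rw [awayToMvPolynomial_mk]
      simp [dehomogenize, j.2]

/-- The degree zero part of `R[X][1 / X i]` is a polynomial ring in the remaining variables. -/
noncomputable def MvPolynomial.awayEquiv :
    HomogeneousLocalization.Away (homogeneousSubmodule σ R) (X i) ≃+*
      MvPolynomial {j // j ≠ i} R :=
  .ofBijective _ (awayToMvPolynomial_bijective R i)

end

open TopologicalSpace in
/-- The dimension of a space is bounded by the dimensions of the members of an open cover. -/
theorem topologicalKrullDim_le_of_iSup_eq_top {Y ι : Type*} [TopologicalSpace Y]
    (U : ι → Opens Y) (hU : ⨆ i, U i = ⊤) (n : WithBot ℕ∞)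
    (h : ∀ i, topologicalKrullDim (U i) ≤ n) : topologicalKrullDim Y ≤ n := by
  rw [topologicalKrullDim, Order.krullDim_eq_iSup_coheight]
  refine iSup_le fun Z ↦ ?_
  obtain ⟨y, hy⟩ := Z.isIrreducible.nonempty
  obtain ⟨i, hi⟩ := Opens.mem_iSup.mp (hU.ge (Set.mem_univ y))
  have hemb := (U i).isOpenEmbedding'
  obtain ⟨W, hW⟩ := (IrreducibleCloseds.orderIsoOfIsOpenEmbedding _ hemb).surjective
    ⟨Z, ⟨y, hi⟩, hy⟩
  have hW : IrreducibleCloseds.map _ hemb.continuous W = Z := congrArg Subtype.val hW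
  rw [← hW, hemb.coheight_map]
  exact (Order.coheight_le_krullDim W).trans (h i)

open TopologicalSpace in
/-- A closed embedding of a space of dimension `n` into an irreducible space of dimension at
most `n` is surjective. -/
theorem Topology.IsClosedEmbedding.surjective_of_topologicalKrullDim_le {X Y : Type*}
    [TopologicalSpace X] [TopologicalSpace Y] [IrreducibleSpace Y] {f : X → Y}
    (hf : IsClosedEmbedding f) (n : ℕ) (hX : topologicalKrullDim X = n)
    (hY : topologicalKrullDim Y ≤ n) : Function.Surjective f := by
  by_contra hsurj
  have : Nonempty (IrreducibleCloseds X) := by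
    rw [← not_isEmpty_iff]
    intro hemp
    rw [topologicalKrullDim, Order.krullDim_eq_bot] at hX
    simp at hX
  obtain ⟨s, hs⟩ : ∃ s : LTSeries (IrreducibleCloseds X), s.length = n :=
    Order.le_krullDim_iff.mp hX.ge
  let T : IrreducibleCloseds Y := ⟨Set.univ, IrreducibleSpace.isIrreducible_univ Y, isClosed_univ⟩
  let t := s.map (IrreducibleCloseds.map f hf.continuous)
    (IrreducibleCloseds.map_strictMono_of_isInducing hf.isInducing)
  have ht : t.last < T := by
    refine lt_of_le_of_ne (fun _ _ ↦ trivial) fun h ↦ hsurj fun y ↦ ?_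
    have hy : y ∈ (t.last : Set Y) := by rw [h]; trivial
    have : (t.last : Set Y) ⊆ Set.range f :=
      closure_minimal (Set.image_subset_range _ _) hf.isClosed_range
    exact this hy
  have := (Order.LTSeries.length_le_krullDim (t.snoc T ht)).trans hY
  norm_cast at this
  simp [t] at this
  omega

section

variable (n : ℕ)

theorem MvPolynomial.X_mem_homogeneousSubmodule_one {R σ : Type*} [CommRing R] (i : σ) :
    X i ∈ homogeneousSubmodule σ R 1 :=
  isHomogeneous_X R i

/-- The standard affine chart `X i ≠ 0` of projective space. -/
noncomputable def ProjSpace.chart (i : Fin (n + 1)) : (ProjSpace n).Opens :=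
  Proj.basicOpen (homogeneousSubmodule (Fin (n + 1)) ℂ) (X i)

theorem ProjSpace.isAffineOpen_chart (i : Fin (n + 1)) : IsAffineOpen (ProjSpace.chart n i) :=
  Proj.isAffineOpen_basicOpen _ _ (X_mem_homogeneousSubmodule_one i) one_pos

theorem ProjSpace.iSup_chart : ⨆ i, ProjSpace.chart n i = ⊤ := by
  refine Proj.iSup_basicOpen_eq_top' _ _ (fun i ↦ ⟨1, X_mem_homogeneousSubmodule_one i⟩) ?_
  refine top_le_iff.mp fun p _ ↦ ?_
  induction p using MvPolynomial.induction_on with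
  | C r =>
    exact Subalgebra.algebraMap_mem (Algebra.adjoin (homogeneousSubmodule (Fin (n + 1)) ℂ 0) _)
      ⟨C r, isHomogeneous_C _ _⟩
  | add p q hp hq => exact add_mem (hp trivial) (hq trivial)
  | mul_X p j hp => exact mul_mem (hp trivial) (Algebra.subset_adjoin ⟨j, rfl⟩)

/-- The ring of functions on a standard chart is a polynomial ring in `n` variables. -/
noncomputable def ProjSpace.chartEquiv (i : Fin (n + 1)) :
    MvPolynomial {j // j ≠ i} ℂ ≃+* Γ(ProjSpace n, ProjSpace.chart n i) :=
  (awayEquiv ℂ i).symm.trans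
    (Proj.basicOpenIsoAway _ _ (X_mem_homogeneousSubmodule_one i) one_pos).commRingCatIsoToRingEquiv

instance ProjSpace.irreducibleSpace : IrreducibleSpace (ProjSpace n) := by
  let A := homogeneousSubmodule (Fin (n + 1)) ℂ
  let η : ProjectiveSpectrum A :=
    { asHomogeneousIdeal := ⊥
      isPrime := by
        rw [HomogeneousIdeal.toIdeal_bot]; exact Ideal.isPrime_bot
      not_irrelevant_le := by
        intro h
        have : (X 0 : MvPolynomial (Fin (n + 1)) ℂ) ∈ HomogeneousIdeal.irrelevant A := by
          rw [HomogeneousIdeal.mem_irrelevant_iff, GradedRing.proj_apply,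
            DirectSum.decompose_of_mem_ne A (X_mem_homogeneousSubmodule_one 0) one_ne_zero]
        exact X_ne_zero (R := ℂ) (0 : Fin (n + 1)) (by
          have h0 := h this
          rwa [← HomogeneousIdeal.mem_iff, HomogeneousIdeal.toIdeal_bot, Ideal.mem_bot] at h0) }
  have hη : closure {η} = Set.univ := by
    rw [← ProjectiveSpectrum.zeroLocus_vanishingIdeal_eq_closure,
      ProjectiveSpectrum.vanishingIdeal_singleton]
    exact ProjectiveSpectrum.zeroLocus_bot A
  change IrreducibleSpace (ProjectiveSpectrum A)
  rw [irreducibleSpace_def, Set.top_eq_univ, ← hη]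
  exact isIrreducible_singleton.closure

theorem ProjSpace.topologicalKrullDim_le : topologicalKrullDim (ProjSpace n) ≤ n := by
  refine topologicalKrullDim_le_of_iSup_eq_top _ (ProjSpace.iSup_chart n) _ fun i ↦ ?_
  have e := (ProjSpace.isAffineOpen_chart n i).isoSpec.schemeIsoToHomeo
  refine (IsHomeomorph.topologicalKrullDim_eq e e.isHomeomorph).trans_le ?_
  refine (PrimeSpectrum.topologicalKrullDim_eq_ringKrullDim _).trans_le ?_
  rw [← ringKrullDim_eq_of_ringEquiv (ProjSpace.chartEquiv n i),
    MvPolynomial.ringKrullDim_of_isNoetherianRing]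
  simp

instance : IsSeparated (ProjSpace.structMor n) := by
  have : IsSeparated (Proj.toSpecZero (homogeneousSubmodule (Fin (n + 1)) ℂ)) := Proj.isSeparated _
  exact MorphismProperty.comp_mem _ _ _ this inferInstance

theorem AlgebraicGeometry.IsAffineOpen.injective_SpecMap_app {X Y : Scheme} (f : X ⟶ Y)
    [IsAffineHom f] (hf : Function.Injective f) {U : Y.Opens} (hU : IsAffineOpen U) :
    Function.Injective (Spec.map (f.app U)) := by
  have h := hU.SpecMap_appLE_fromSpec f (hU.preimage f) le_rfl
  rw [← Scheme.Hom.app_eq_appLE] at h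
  refine Function.Injective.of_comp (f := hU.fromSpec) ?_
  rw [← TopCat.coe_comp, ← Scheme.Hom.comp_base, h]
  simpa using hf.comp (hU.preimage f).fromSpec.isOpenEmbedding.injective

theorem AlgebraicGeometry.IsAffineOpen.surjective_SpecMap_app {X Y : Scheme} (f : X ⟶ Y)
    [IsAffineHom f] (hf : Function.Surjective f) {U : Y.Opens} (hU : IsAffineOpen U) :
    Function.Surjective (Spec.map (f.app U)) := by
  have h := hU.SpecMap_appLE_fromSpec f (hU.preimage f) le_rfl
  rw [← Scheme.Hom.app_eq_appLE] at h
  intro p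
  obtain ⟨x, hx⟩ := hf (hU.fromSpec p)
  obtain ⟨q, rfl⟩ : x ∈ Set.range (hU.preimage f).fromSpec := by
    rw [IsAffineOpen.range_fromSpec]
    change f x ∈ U
    rw [hx, ← SetLike.mem_coe, ← hU.range_fromSpec]
    exact ⟨p, rfl⟩
  refine ⟨q, hU.fromSpec.isOpenEmbedding.injective ?_⟩
  rw [← Scheme.Hom.comp_apply, h, Scheme.Hom.comp_apply, hx]

/-- A finite bijective morphism from an integral scheme to `ℙⁿ` is an isomorphism. -/
theorem ProjSpace.isIso_of_isFinite_of_bijective {X : Scheme} [IsIntegral X]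
    (φ : X ⟶ ProjSpace n) [IsFinite φ] (hφ : Function.Bijective φ) : IsIso φ := by
  refine (IsZariskiLocalAtTarget.iff_of_iSup_eq_top (P := .isomorphisms Scheme) _
    (ProjSpace.iSup_chart n)).mpr fun i ↦ ?_
  have hU := ProjSpace.isAffineOpen_chart n i
  refine (isIso_morphismRestrict_iff_isIso_app φ hU).mpr ?_
  let e := ProjSpace.chartEquiv n i
  have : Nonempty (φ ⁻¹ᵁ ProjSpace.chart n i) := by
    have : Nonempty (PrimeSpectrum Γ(ProjSpace n, ProjSpace.chart n i)) :=
      ⟨PrimeSpectrum.comap e.symm.toRingHom ⊥⟩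
    obtain ⟨p⟩ := this
    obtain ⟨x, hx⟩ := hφ.2 (hU.fromSpec p)
    refine ⟨x, ?_⟩
    change φ x ∈ ProjSpace.chart n i
    rw [hx, ← SetLike.mem_coe, ← hU.range_fromSpec]
    exact ⟨p, rfl⟩
  let g := (φ.app (ProjSpace.chart n i)).hom
  let := (g.comp e.toRingHom).toAlgebra
  have hcomap : Function.Bijective (PrimeSpectrum.comap (g.comp e.toRingHom)) := by
    rw [PrimeSpectrum.comap_comp]
    exact (PrimeSpectrum.comapEquiv e).symm.bijective.comp
      ⟨hU.injective_SpecMap_app φ hφ.1, hU.surjective_SpecMap_app φ hφ.2⟩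
  have : FaithfulSMul (MvPolynomial {j // j ≠ i} ℂ) Γ(X, φ ⁻¹ᵁ ProjSpace.chart n i) := by
    rw [faithfulSMul_iff_algebraMap_injective, RingHom.injective_iff_ker_eq_bot, eq_bot_iff,
      ← Ideal.zero_eq_bot, ← nilradical_eq_zero]
    exact (PrimeSpectrum.denseRange_comap_iff_ker_le_nilRadical _).mp hcomap.2.denseRange
  have : Algebra.IsIntegral (MvPolynomial {j // j ≠ i} ℂ) Γ(X, φ ⁻¹ᵁ ProjSpace.chart n i) := by
    rw [← algebraMap_isIntegral_iff]
    exact (e.toRingHom.isIntegral_of_surjective e.surjective).trans _ _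
      (φ.finite_app _ hU).to_isIntegral
  rw [ConcreteCategory.isIso_iff_bijective]
  exact (e.bijective.of_comp_iff g).mp
    (MvPolynomial.bijective_algebraMap_of_comap_injective hcomap.1)

end

/-- If a projective (reduced, proper over `ℂ`) variety `X` admits a morphism over `ℂ`
to `ℙ^{dim X}` that is injective on points, then that morphism is an isomorphism; in
particular, if `X` is not isomorphic to projective space, every injective morphism
`X ⟶ ℙ^s` satisfies `s ≥ dim X + 1`. -/
theorem stmt7 (X : Scheme) [IsReduced X]
    (sX : X ⟶ Spec (CommRingCat.of ℂ)) [IsProper sX]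
    (n : ℕ) (hdim : topologicalKrullDim X = ((n : ℕ∞) : WithBot ℕ∞))
    (φ : X ⟶ ProjSpace n) (hφ : φ ≫ ProjSpace.structMor n = sX)
    (hinj : Function.Injective φ.base) :
    IsIso φ := by
  have : IsProper (φ ≫ ProjSpace.structMor n) := hφ ▸ inferInstance
  have : IsProper φ := .of_comp φ (ProjSpace.structMor n)
  have : LocallyQuasiFinite φ := .of_injective hinj
  have : IsFinite φ := .of_isProper_of_locallyQuasiFinite φ
  have hemb : Topology.IsClosedEmbedding φ :=
    .of_continuous_injective_isClosedMap φ.continuous hinj φ.isClosedMap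
  have hsurj : Function.Surjective φ :=
    hemb.surjective_of_topologicalKrullDim_le n hdim (ProjSpace.topologicalKrullDim_le n)
  have : IrreducibleSpace X :=
    let e := (hemb.isEmbedding.toHomeomorphOfSurjective hsurj).symm
    e.surjective.irreducibleSpace (f := e) e.continuous
  have : IsIntegral X := isIntegral_of_irreducibleSpace_of_isReduced X
  exact ProjSpace.isIso_of_isFinite_of_bijective n φ ⟨hinj, hsurj⟩
end

section
/- For all n₁,…,n_r ≥ 1, every injective morphism ℙ^{n₁} × ⋯ × ℙ^{n_r} → ℙ^s satisfies s ≥ 2(n₁+⋯+n_r) − min{n₁,…,n_r}. -/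
open AlgebraicGeometry CategoryTheory MvPolynomial

attribute [local instance] MvPolynomial.gradedAlgebra

open CategoryTheory.Limits in
/-- The fibered product `ℙ^{n 0} ×_ℂ ⋯ ×_ℂ ℙ^{n (r-1)}` over `Spec ℂ`, together with
its structure morphism to `Spec ℂ`. -/
noncomputable def multiProj : (r : ℕ) → (Fin r → ℕ) →
    Σ X : Scheme, X ⟶ Spec (CommRingCat.of ℂ)
  | 0, _ => ⟨Spec (CommRingCat.of ℂ), 𝟙 _⟩
  | r + 1, n =>
    ⟨pullback (ProjSpace.structMor (n 0)) (multiProj r (n ∘ Fin.succ)).2,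
      pullback.fst _ _ ≫ ProjSpace.structMor (n 0)⟩

/-- `SpecChain p x y` says that there is a chain of `p` proper specializations from `x` to `y`. -/
inductive SpecChain {X : Type*} [TopologicalSpace X] : ℕ → X → X → Prop
  | refl (x : X) : SpecChain 0 x x
  | cons {p : ℕ} {x y z : X} (h : x ⤳ y) (hne : x ≠ y) (c : SpecChain p y z) :
      SpecChain (p + 1) x z

namespace SpecChain

variable {W Z X : Type*} [TopologicalSpace W] [TopologicalSpace Z] [TopologicalSpace X]

theorem trans {p q : ℕ} {x y z : X} (h₁ : SpecChain p x y) (h₂ : SpecChain q y z) :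
    SpecChain (p + q) x z := by
  induction h₁ with
  | refl x => simpa using h₂
  | cons h hne _ ih => rw [Nat.add_right_comm]; exact cons h hne (ih h₂)

theorem specializes {p : ℕ} {x y : X} (h : SpecChain p x y) : x ⤳ y := by
  induction h with
  | refl x => exact specializes_rfl
  | cons h _ _ ih => exact h.trans ih

theorem map {f : X → Z} (hf : ∀ ⦃x y⦄, x ⤳ y → f x ⤳ f y) (hinj : Function.Injective f)
    {p : ℕ} {x y : X} (h : SpecChain p x y) : SpecChain p (f x) (f y) := by
  induction h with
  | refl x => exact refl _
  | cons h hne _ ih => exact cons (hf h) (hinj.ne hne) ih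

/-- Chains lift along generalizing maps. -/
theorem exists_lift {g : W → Z} {f : Z → X} (hg : Continuous g) (hfg : GeneralizingMap (f ∘ g))
    {p : ℕ} {x y : X} (h : SpecChain p x y) (w : W) (hw : f (g w) = y) :
    ∃ w' : W, f (g w') = x ∧ SpecChain p (g w') (g w) := by
  induction h with
  | refl x => exact ⟨w, hw, refl _⟩
  | cons h hne _ ih =>
    obtain ⟨v, rfl, c⟩ := ih hw
    obtain ⟨u, huv, rfl⟩ := hfg h
    exact ⟨u, rfl, cons (huv.map hg) (fun e ↦ hne (congrArg f e)) c⟩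

end SpecChain

namespace AlgebraicGeometry

variable {P X Y S : Scheme.{0}} {fst : P ⟶ X} {snd : P ⟶ Y} {f : X ⟶ S} {g : Y ⟶ S}

theorem exists_specChain_of_isPullback_left [Subsingleton S] [IsIntegral S]
    (sq : IsPullback fst snd f g) {p : ℕ} {x x' : X} (hx : SpecChain p x x')
    (z : P) (hz : fst z = x') :
    ∃ z' : P, fst z' = x ∧ snd z' = snd z ∧ SpecChain p z' z := by
  let y := snd z
  let i := Y.fromSpecResidueField y
  have sq' := (IsPullback.of_hasPullback snd i).flip
  have hflat : Flat (Limits.pullback.fst snd i ≫ fst) :=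
    MorphismProperty.of_isPullback (P := @Flat) (sq'.paste_vert sq.flip)
      (inferInstance : Flat (i ≫ g))
  obtain ⟨w, hw, -⟩ := Scheme.Pullback.exists_preimage_pullback (f := snd) (g := i) z default
    (by simp [i, y])
  obtain ⟨w', h₁, h₂⟩ := SpecChain.exists_lift (g := Limits.pullback.fst snd i) (f := fst)
    (Limits.pullback.fst snd i).continuous
    (by simpa using Flat.generalizingMap (Limits.pullback.fst snd i ≫ fst)) hx w (by rw [hw, hz])
  refine ⟨_, h₁, ?_, hw ▸ h₂⟩
  rw [← Scheme.Hom.comp_apply, Limits.pullback.condition, Scheme.Hom.comp_apply]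
  exact Y.fromSpecResidueField_apply y _

theorem exists_specChain_of_isPullback [Subsingleton S] [IsIntegral S]
    (sq : IsPullback fst snd f g) {p q : ℕ} {x x' : X} {y y' : Y} (hx : SpecChain p x x')
    (hy : SpecChain q y y') :
    ∃ z z' : P, fst z = x ∧ snd z = y ∧ fst z' = x' ∧ snd z' = y' ∧ SpecChain (p + q) z z' := by
  obtain ⟨z₀, h₁, h₂⟩ := Scheme.Pullback.exists_preimage_pullback (f := f) (g := g) x' y'
    (Subsingleton.elim _ _)
  obtain ⟨z', h₁', h₂'⟩ : ∃ z' : P, fst z' = x' ∧ snd z' = y' := by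
    refine ⟨sq.isoPullback.inv z₀, ?_, ?_⟩ <;> simp [← Scheme.Hom.comp_apply, h₁, h₂]
  obtain ⟨v, hv₁, hv₂, hv⟩ := exists_specChain_of_isPullback_left sq.flip hy z' h₂'
  obtain ⟨u, hu₁, hu₂, hu⟩ := exists_specChain_of_isPullback_left sq hx v (hv₂.trans h₁')
  exact ⟨u, z', hu₁, hu₂.trans hv₁, h₁', h₂', hu.trans hv⟩

end AlgebraicGeometry

theorem SpecChain.height_add_le {R : Type*} [CommRing R] {n : ℕ} {x y : PrimeSpectrum R}
    (h : SpecChain n x y) (I : Ideal R) (hI : I ≤ x.asIdeal) [IsNoetherianRing R] :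
    (x.asIdeal.map (Ideal.Quotient.mk I)).height + n ≤
      (y.asIdeal.map (Ideal.Quotient.mk I)).height := by
  induction h with
  | refl x => simp
  | @cons p x y z h hne _ ih =>
    rw [← PrimeSpectrum.le_iff_specializes] at h
    have hlt : x.asIdeal < y.asIdeal := lt_of_le_of_ne h fun e ↦ hne (PrimeSpectrum.ext e)
    have hIy : I ≤ y.asIdeal := hI.trans h
    have hsurj := Ideal.Quotient.mk_surjective (I := I)
    have : (x.asIdeal.map (Ideal.Quotient.mk I)).IsPrime :=
      Ideal.map_isPrime_of_surjective hsurj (by simpa using hI)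
    have : (y.asIdeal.map (Ideal.Quotient.mk I)).IsPrime :=
      Ideal.map_isPrime_of_surjective hsurj (by simpa using hIy)
    have hlt' : x.asIdeal.map (Ideal.Quotient.mk I) < y.asIdeal.map (Ideal.Quotient.mk I) := by
      refine lt_of_le_of_ne (Ideal.map_mono h) fun e ↦ hlt.ne ?_
      have := congrArg (Ideal.comap (Ideal.Quotient.mk I)) e
      rwa [Ideal.comap_map_of_surjective' _ hsurj, Ideal.comap_map_of_surjective' _ hsurj,
        Ideal.mk_ker, sup_eq_left.mpr hI, sup_eq_left.mpr hIy] at this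
    have h1 := Ideal.height_add_one_le_of_lt_of_isPrime hlt'
    push_cast
    calc _ = (x.asIdeal.map (Ideal.Quotient.mk I)).height + 1 + p := by
          rw [add_assoc, add_comm (1 : ℕ∞)]
      _ ≤ _ := by gcongr
      _ ≤ _ := ih hIy

open TensorProduct in
/-- The dimension inequality in affine space: prime ideals whose sum has the origin as its
only zero have coheights adding up to at most the dimension of the space. -/
theorem MvPolynomial.add_le_card_of_specChain {K σ : Type} [Field K] [Fintype σ] {a b : ℕ}
    {p q m : Spec (CommRingCat.of (MvPolynomial σ K))}
    (hm : m.asIdeal = Ideal.span (Set.range X))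
    (hpq : ∀ I : Ideal (MvPolynomial σ K), I.IsPrime → p.asIdeal ≤ I → q.asIdeal ≤ I →
      ∀ i, X i ∈ I)
    (hp : SpecChain a p m) (hq : SpecChain b q m) : a + b ≤ Fintype.card σ := by
  let S := MvPolynomial σ K
  let T := S ⊗[K] S
  let ι₁ : S →+* T := Algebra.TensorProduct.includeLeftRingHom
  let ι₂ : S →+* T := (Algebra.TensorProduct.includeRight : S →ₐ[K] T)
  have : IsNoetherianRing T := Algebra.FiniteType.isNoetherianRing S T
  have sq := (CommRingCat.isPushout_tensorProduct K S S).op.map Scheme.Spec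
  have : Subsingleton (Scheme.Spec.obj (.op (CommRingCat.of K))) :=
    inferInstanceAs (Subsingleton (PrimeSpectrum K))
  have : IsIntegral (Scheme.Spec.obj (.op (CommRingCat.of K))) :=
    inferInstanceAs (IsIntegral (Spec (CommRingCat.of K)))
  obtain ⟨z, z', h₁, h₂, h₁', h₂', hz⟩ := AlgebraicGeometry.exists_specChain_of_isPullback sq hq hp
  replace h₁ : ι₂ ⁻¹' (z.asIdeal : Set T) = (q.asIdeal : Set S) :=
    congrArg (fun x : Spec (CommRingCat.of S) ↦ (x.asIdeal : Set S)) h₁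
  replace h₂ : ι₁ ⁻¹' (z.asIdeal : Set T) = (p.asIdeal : Set S) :=
    congrArg (fun x : Spec (CommRingCat.of S) ↦ (x.asIdeal : Set S)) h₂
  replace h₁' : ι₂ ⁻¹' (z'.asIdeal : Set T) = (m.asIdeal : Set S) :=
    congrArg (fun x : Spec (CommRingCat.of S) ↦ (x.asIdeal : Set S)) h₁'
  replace h₂' : ι₁ ⁻¹' (z'.asIdeal : Set T) = (m.asIdeal : Set S) :=
    congrArg (fun x : Spec (CommRingCat.of S) ↦ (x.asIdeal : Set S)) h₂'
  let I : Ideal T := z.asIdeal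
  let J : Ideal T := z'.asIdeal
  have hIJ : I ≤ J := (PrimeSpectrum.le_iff_specializes (R := T) z z').mpr hz.specializes
  have hJ : J.IsPrime := z'.isPrime
  let d : σ → T := fun i ↦ ι₁ (X i) - ι₂ (X i)
  have hX (i : σ) : (X i : S) ∈ (m.asIdeal : Set S) := hm ▸ Ideal.subset_span ⟨i, rfl⟩
  have hX₁ (i : σ) : ι₁ (X i) ∈ J := by have := hX i; rwa [← h₂'] at this
  have hX₂ (i : σ) : ι₂ (X i) ∈ J := by have := hX i; rwa [← h₁'] at this
  have hmax (L : Ideal T) (hL : L ≤ J) (hL₁ : ∀ i, ι₁ (X i) ∈ L) (hL₂ : ∀ i, ι₂ (X i) ∈ L) :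
      J ≤ L := by
    have key (t : T) : ∃ c : K, t - algebraMap K T c ∈ L := by
      have hpoly (ι : S →ₐ[K] T) (hι : ∀ i, ι (X i) ∈ L) (f : S) :
          ∃ c : K, ι f - algebraMap K T c ∈ L := by
        induction f using MvPolynomial.induction_on with
        | C c => exact ⟨c, by
            rw [show (C c : S) = algebraMap K S c from rfl, ι.commutes, sub_self]
            exact L.zero_mem⟩
        | add f g hf hg =>
          obtain ⟨c, hc⟩ := hf
          obtain ⟨e, he⟩ := hg
          exact ⟨c + e, by simpa [add_sub_add_comm] using L.add_mem hc he⟩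
        | mul_X f i _ => exact ⟨0, by simpa using L.mul_mem_left _ (hι i)⟩
      induction t using TensorProduct.induction_on with
      | zero => exact ⟨0, by simp⟩
      | tmul f g =>
        obtain ⟨c, hc⟩ := hpoly Algebra.TensorProduct.includeLeft hL₁ f
        obtain ⟨e, he⟩ := hpoly Algebra.TensorProduct.includeRight hL₂ g
        refine ⟨c * e, ?_⟩
        have h := L.add_mem (L.mul_mem_right (Algebra.TensorProduct.includeRight g) hc)
          (L.mul_mem_left (algebraMap K T c) he)
        have hfg : (f ⊗ₜ[K] g : T) = Algebra.TensorProduct.includeLeft (R := K) (S := K) f *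
            Algebra.TensorProduct.includeRight g := by simp
        rw [hfg, map_mul]
        convert! h using 1
        ring
      | add f g hf hg =>
        obtain ⟨c, hc⟩ := hf
        obtain ⟨e, he⟩ := hg
        exact ⟨c + e, by simpa [add_sub_add_comm] using L.add_mem hc he⟩
    intro t ht
    obtain ⟨c, hc⟩ := key t
    have hcJ : algebraMap K T c ∈ J := by simpa using J.sub_mem ht (hL hc)
    obtain rfl : c = 0 := by
      by_contra hc0
      exact hJ.ne_top (Ideal.eq_top_of_isUnit_mem _ hcJ ((Ne.isUnit hc0).map _))
    simpa using hc
  have hmin (L : Ideal T) (hL : L.IsPrime) (hIL : I ≤ L) (hd : ∀ i, d i ∈ L) (hLJ : L ≤ J) :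
      J ≤ L := by
    have heq : (Ideal.Quotient.mk L).comp ι₁ = (Ideal.Quotient.mk L).comp ι₂ := by
      refine MvPolynomial.ringHom_ext (fun c ↦ ?_) fun i ↦ Ideal.Quotient.eq.mpr (hd i)
      have h : ι₁ (C c) = ι₂ (C c) :=
        (Algebra.TensorProduct.includeLeft (R := K) (S := K) (A := S) (B := S)).commutes c |>.trans
          ((Algebra.TensorProduct.includeRight (R := K) (A := S) (B := S)).commutes c).symm
      exact congrArg (Ideal.Quotient.mk L) h
    have hcomap : L.comap ι₁ = L.comap ι₂ := by
      rw [← L.mk_ker, RingHom.comap_ker, RingHom.comap_ker, heq]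
    have h := hpq (L.comap ι₁) inferInstance
      (fun s hs ↦ hIL (show s ∈ ι₁ ⁻¹' (z.asIdeal : Set T) from h₂ ▸ hs))
      (hcomap ▸ fun s hs ↦ hIL (show s ∈ ι₂ ⁻¹' (z.asIdeal : Set T) from h₁ ▸ hs))
    exact hmax L hLJ h (fun i ↦ by have := h i; rwa [hcomap] at this)
  have hJp : (J.map (Ideal.Quotient.mk I)).IsPrime :=
    Ideal.map_isPrime_of_surjective Ideal.Quotient.mk_surjective (by simpa using hIJ)
  have hle : (J.map (Ideal.Quotient.mk I)).height ≤ Fintype.card σ := by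
    have hmem : J.map (Ideal.Quotient.mk I) ∈
        (Ideal.span (Set.range fun i ↦ Ideal.Quotient.mk I (d i))).minimalPrimes := by
      refine ⟨⟨hJp, ?_⟩, fun L ⟨hL, hdL⟩ hLJ ↦ ?_⟩
      · rw [Ideal.span_le]
        rintro _ ⟨i, rfl⟩
        exact Ideal.mem_map_of_mem _ (J.sub_mem (hX₁ i) (hX₂ i))
      · rw [Ideal.map_le_iff_le_comap]
        refine hmin _ inferInstance ?_ (fun i ↦ hdL (Ideal.subset_span ⟨i, rfl⟩)) ?_
        · simpa using Ideal.ker_le_comap (Ideal.Quotient.mk I) (K := L)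
        · refine (Ideal.comap_mono hLJ).trans ?_
          rw [Ideal.comap_map_of_surjective' _ Ideal.Quotient.mk_surjective, Ideal.mk_ker,
            sup_eq_left.mpr hIJ]
    refine (Ideal.height_le_card_of_mem_minimalPrimes_span (Set.finite_range _) hmem).trans ?_
    rw [← Nat.card_coe_set_eq, ← Nat.card_eq_fintype_card]
    exact_mod_cast Finite.card_range_le _
  have hge := SpecChain.height_add_le (R := T) hz I le_rfl
  have : ((b + a : ℕ) : ℕ∞) ≤ Fintype.card σ := (le_add_self.trans hge).trans hle
  rw [add_comm]
  exact_mod_cast this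

namespace ProjSpace

variable {n : ℕ}

theorem specializes_iff {x y : ProjectiveSpectrum (homogeneousSubmodule (Fin (n + 1)) ℂ)} :
    x ⤳ y ↔ x.asHomogeneousIdeal.toIdeal ≤ y.asHomogeneousIdeal.toIdeal := by
  rw [specializes_iff_mem_closure, ← ProjectiveSpectrum.le_iff_mem_closure]
  rfl

theorem mem_span_range_X_iff {σ : Type*} {f : MvPolynomial σ ℂ} :
    f ∈ Ideal.span (Set.range X) ↔ constantCoeff f = 0 := by
  rw [← Set.image_univ, mem_ideal_span_X_image]
  constructor
  · intro h
    by_contra hf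
    obtain ⟨i, -, hi⟩ := h 0 (mem_support_iff.mpr hf)
    exact hi rfl
  · intro hf m hm
    by_contra! h
    obtain rfl : m = 0 := by ext i; simpa using h i
    exact mem_support_iff.mp hm hf

theorem irrelevant_eq_span :
    (HomogeneousIdeal.irrelevant (homogeneousSubmodule (Fin (n + 1)) ℂ)).toIdeal =
      Ideal.span (Set.range X) := by
  ext f
  have h : (DirectSum.decompose (homogeneousSubmodule (Fin (n + 1)) ℂ) f 0 :
      MvPolynomial (Fin (n + 1)) ℂ) = homogeneousComponent 0 f :=
    decomposition.decompose'_apply f 0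
  rw [mem_span_range_X_iff, HomogeneousIdeal.mem_iff, HomogeneousIdeal.mem_irrelevant_iff,
    GradedRing.proj_apply, h, homogeneousComponent_zero, C_eq_zero, constantCoeff_eq]

theorem isPrime_span_X_image {σ : Type*} (s : Set σ) :
    (Ideal.span (X '' s) : Ideal (MvPolynomial σ ℂ)).IsPrime := by
  classical
  let e : MvPolynomial σ ℂ →ₐ[ℂ] MvPolynomial σ ℂ := aeval fun i ↦ if i ∈ s then 0 else X i
  have key (f : MvPolynomial σ ℂ) : f - e f ∈ (Ideal.span (X '' s) : Ideal (MvPolynomial σ ℂ)) := by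
    rw [← Ideal.Quotient.eq]
    suffices (Ideal.Quotient.mkₐ ℂ (Ideal.span (X '' s))) =
        (Ideal.Quotient.mkₐ ℂ (Ideal.span (X '' s))).comp e from DFunLike.congr_fun this f
    ext i
    by_cases hi : i ∈ s
    · simpa [e, hi] using Ideal.Quotient.eq_zero_iff_mem.mpr
        (Ideal.subset_span (Set.mem_image_of_mem X hi))
    · simp [e, hi]
  have : Ideal.span (X '' s) = RingHom.ker e := by
    refine le_antisymm (Ideal.span_le.mpr ?_) fun f hf ↦ ?_
    · rintro _ ⟨i, hi, rfl⟩
      simp [e, hi]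
    · simpa [RingHom.mem_ker.mp hf] using key f
  rw [this]
  exact RingHom.ker_isPrime _

theorem X_mem_span_X_image {σ : Type*} {s : Set σ} {i : σ} :
    (X i : MvPolynomial σ ℂ) ∈ Ideal.span (X '' s) ↔ i ∈ s := by
  classical
  simp [mem_ideal_span_X_image, support_X, Finsupp.single_apply]

theorem irrelevant_le_iff {I : HomogeneousIdeal (homogeneousSubmodule (Fin (n + 1)) ℂ)} :
    HomogeneousIdeal.irrelevant (homogeneousSubmodule (Fin (n + 1)) ℂ) ≤ I ↔
      ∀ i, X i ∈ I.toIdeal := by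
  change (HomogeneousIdeal.irrelevant (homogeneousSubmodule (Fin (n + 1)) ℂ)).toIdeal ≤
    I.toIdeal ↔ _
  rw [irrelevant_eq_span, Ideal.span_le, Set.range_subset_iff]
  rfl

/-- The generic point of the linear subspace of `ℙⁿ` on which the coordinates in `s` vanish. -/
noncomputable def linearPt (s : Finset (Fin (n + 1))) (hs : ∃ i, i ∉ s) : ProjSpace n :=
  show ProjectiveSpectrum (homogeneousSubmodule (Fin (n + 1)) ℂ) from
  { asHomogeneousIdeal := ⟨Ideal.span (X '' s), Ideal.homogeneous_span _ _ (by
      rintro _ ⟨i, -, rfl⟩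
      exact ⟨1, isHomogeneous_X _ _⟩)⟩
    isPrime := isPrime_span_X_image _
    not_irrelevant_le := fun h ↦ hs.elim fun i hi ↦
      hi (X_mem_span_X_image.mp (irrelevant_le_iff.mp h i)) }

theorem linearPt_specializes_iff {s : Finset (Fin (n + 1))} {hs : ∃ i, i ∉ s} {w : ProjSpace n} :
    linearPt s hs ⤳ w ↔ ∀ i ∈ s, (X i : MvPolynomial (Fin (n + 1)) ℂ) ∈
      (show ProjectiveSpectrum (homogeneousSubmodule (Fin (n + 1)) ℂ) from
        w).asHomogeneousIdeal.toIdeal := by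
  refine specializes_iff.trans (Ideal.span_le.trans ?_)
  simp [Set.subset_def]

theorem X_mem_linearPt {s : Finset (Fin (n + 1))} {hs : ∃ i, i ∉ s} {i : Fin (n + 1)} :
    (X i : MvPolynomial (Fin (n + 1)) ℂ) ∈
      (show ProjectiveSpectrum (homogeneousSubmodule (Fin (n + 1)) ℂ) from
        linearPt s hs).asHomogeneousIdeal.toIdeal ↔ i ∈ s :=
  X_mem_span_X_image.trans Finset.mem_coe

theorem exists_specChain_linearPt (s : Finset (Fin (n + 1))) (hs : ∃ i, i ∉ s) :
    ∃ y, SpecChain (n - s.card) (linearPt s hs) y := by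
  generalize hk : n - s.card = k
  induction k generalizing s with
  | zero => exact ⟨_, .refl _⟩
  | succ k ih =>
    obtain ⟨i, hi⟩ := hs
    have hc : (insert i s).card = s.card + 1 := Finset.card_insert_of_notMem hi
    have hs' : ∃ j, j ∉ insert i s := by
      by_contra! h
      have := Finset.card_eq_iff_eq_univ (insert i s) |>.mpr (Finset.eq_univ_iff_forall.mpr h)
      rw [Fintype.card_fin] at this
      lia
    obtain ⟨y, hy⟩ := ih (insert i s) hs' (by lia)
    refine ⟨y, .cons (linearPt_specializes_iff.mpr fun j hj ↦ ?_) (fun e ↦ hi ?_) hy⟩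
    · exact X_mem_linearPt.mpr (Finset.mem_insert_of_mem hj)
    · exact X_mem_linearPt.mp (e ▸ X_mem_linearPt.mpr (Finset.mem_insert_self i s))

/-- The projective dimension theorem: closed subsets of `ℙⁿ` of dimensions `a` and `b` with
`a + b ≥ n` intersect. -/
theorem add_lt_of_disjoint {a b : ℕ} {y y' z z' : ProjSpace n} (hy : SpecChain a y y')
    (hz : SpecChain b z z') (h : ∀ w, y ⤳ w → ¬ z ⤳ w) : a + b < n := by
  let 𝒜 := homogeneousSubmodule (Fin (n + 1)) ℂ
  let c : ProjSpace n → Spec (CommRingCat.of (MvPolynomial (Fin (n + 1)) ℂ)) := fun x ↦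
    ⟨(show ProjectiveSpectrum 𝒜 from x).asHomogeneousIdeal.toIdeal,
      (show ProjectiveSpectrum 𝒜 from x).isPrime⟩
  let o : Spec (CommRingCat.of (MvPolynomial (Fin (n + 1)) ℂ)) :=
    ⟨Ideal.span (Set.range X), Set.image_univ ▸ isPrime_span_X_image _⟩
  have hc ⦃x x' : ProjSpace n⦄ (hx : x ⤳ x') : c x ⤳ c x' :=
    (PrimeSpectrum.le_iff_specializes (c x) (c x')).mp (specializes_iff.mp hx)
  have hinj : Function.Injective c := fun x x' hx ↦
    ProjectiveSpectrum.ext (HomogeneousIdeal.toIdeal_injective (congrArg PrimeSpectrum.asIdeal hx))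
  have ho (x : ProjSpace n) : SpecChain 1 (c x) o := by
    have hne : c x ≠ o := fun e ↦ (show ProjectiveSpectrum 𝒜 from x).not_irrelevant_le
      (irrelevant_le_iff.mpr fun i ↦ (congrArg PrimeSpectrum.asIdeal e).ge
        (Ideal.subset_span ⟨i, rfl⟩))
    refine .cons ((PrimeSpectrum.le_iff_specializes (c x) o).mp ?_) hne (.refl o)
    intro f hf
    have h0 := homogeneousComponent_mem_of_mem
      (show ProjectiveSpectrum 𝒜 from x).asHomogeneousIdeal.isHomogeneous hf 0
    rw [homogeneousComponent_zero] at h0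
    refine mem_span_range_X_iff.mpr ?_
    by_contra hne
    exact (c x).isPrime.ne_top (Ideal.eq_top_of_isUnit_mem _ h0 ((Ne.isUnit hne).map C))
  have := add_le_card_of_specChain (a := a + 1) (b := b + 1) (m := o) rfl (fun I hI hyI hzI ↦ ?_)
    ((hy.map hc hinj).trans (ho _)) ((hz.map hc hinj).trans (ho _))
  · rw [Fintype.card_fin] at this
    lia
  · let J : HomogeneousIdeal 𝒜 := I.homogeneousCore 𝒜
    have hJ : J.toIdeal.IsPrime := hI.homogeneousCore
    have hJI : J.toIdeal ≤ I := Ideal.toIdeal_homogeneousCore_le 𝒜 I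
    have hle (x : ProjSpace n) (hx : (c x).asIdeal ≤ I) : (c x).asIdeal ≤ J.toIdeal :=
      (Ideal.homogeneousCore.gc 𝒜 _ _).mp hx
    by_cases hJirr : HomogeneousIdeal.irrelevant 𝒜 ≤ J
    · exact fun i ↦ hJI (irrelevant_le_iff.mp hJirr i)
    · exact (h (show ProjectiveSpectrum 𝒜 from ⟨J, hJ, hJirr⟩) (specializes_iff.mpr (hle y hyI))
        (specializes_iff.mpr (hle z hzI))).elim

theorem proj_comp_C_surjective (n : ℕ) : Function.Surjective
    ((GradedRing.projZeroRingHom' (homogeneousSubmodule (Fin (n + 1)) ℂ)).comp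
      (C : ℂ →+* MvPolynomial (Fin (n + 1)) ℂ)) := by
  rintro ⟨f, hf⟩
  have hC : C (coeff 0 f) = f := by
    rw [← homogeneousComponent_zero, homogeneousComponent_of_mem hf, if_pos rfl]
  refine ⟨coeff 0 f, ?_⟩
  rw [RingHom.comp_apply, hC]
  exact GradedRing.projZeroRingHom'_apply_coe _ (⟨f, hf⟩ : homogeneousSubmodule _ ℂ 0)

instance finiteType (n : ℕ) : Algebra.FiniteType (homogeneousSubmodule (Fin (n + 1)) ℂ 0)
    (MvPolynomial (Fin (n + 1)) ℂ) := by
  classical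
  refine ⟨Finset.univ.image X, eq_top_iff.mpr fun f _ ↦ ?_⟩
  induction f using MvPolynomial.induction_on with
  | C c =>
    exact Subalgebra.algebraMap_mem _
      (⟨C c, isHomogeneous_C _ c⟩ : homogeneousSubmodule (Fin (n + 1)) ℂ 0)
  | add f g hf hg => exact add_mem (hf trivial) (hg trivial)
  | mul_X f i hf => exact mul_mem (hf trivial) (Algebra.subset_adjoin (by simp))

instance isProper_structMor (n : ℕ) : IsProper (structMor n) := by
  have : IsProper (Proj.toSpecZero (homogeneousSubmodule (Fin (n + 1)) ℂ)) := inferInstance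
  have : IsClosedImmersion (Spec.map (CommRingCat.ofHom
      ((GradedRing.projZeroRingHom' (homogeneousSubmodule (Fin (n + 1)) ℂ)).comp
        (C : ℂ →+* MvPolynomial (Fin (n + 1)) ℂ)))) :=
    IsClosedImmersion.spec_of_surjective _ (proj_comp_C_surjective n)
  exact MorphismProperty.comp_mem @IsProper _ _ ‹_› inferInstance

theorem exists_specChain (n : ℕ) : ∃ x y : ProjSpace n, SpecChain n x y :=
  have ⟨y, hy⟩ := exists_specChain_linearPt (∅ : Finset (Fin (n + 1))) ⟨0, by simp⟩
  ⟨_, y, by simpa using hy⟩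

end ProjSpace

instance isProper_multiProj : (r : ℕ) → (n : Fin r → ℕ) → IsProper (multiProj r n).2
  | 0, _ => inferInstanceAs (IsProper (𝟙 (Spec (CommRingCat.of ℂ))))
  | r + 1, n => by
    have := isProper_multiProj r (n ∘ Fin.succ)
    exact inferInstanceAs (IsProper (Limits.pullback.fst (ProjSpace.structMor (n 0))
      (multiProj r (n ∘ Fin.succ)).2 ≫ ProjSpace.structMor (n 0)))

instance : Subsingleton (Spec (CommRingCat.of ℂ)) :=
  inferInstanceAs (Subsingleton (PrimeSpectrum ℂ))

theorem exists_specChain_multiProj_succ {r : ℕ} (n : Fin (r + 1) → ℕ) {p q : ℕ}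
    {x x' : ProjSpace (n 0)} {y y' : (multiProj r (n ∘ Fin.succ)).1} (hx : SpecChain p x x')
    (hy : SpecChain q y y') :
    ∃ z z' : (multiProj (r + 1) n).1, SpecChain (p + q) z z' ∧
      Limits.pullback.fst (ProjSpace.structMor (n 0)) (multiProj r (n ∘ Fin.succ)).2 z = x ∧
      Limits.pullback.snd (ProjSpace.structMor (n 0)) (multiProj r (n ∘ Fin.succ)).2 z = y :=
  have ⟨z, z', h₁, h₂, _, _, h⟩ :=
    exists_specChain_of_isPullback (IsPullback.of_hasPullback _ _) hx hy
  ⟨z, z', h, h₁, h₂⟩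

theorem exists_specChain_multiProj : (r : ℕ) → (n : Fin r → ℕ) →
    ∃ z z' : (multiProj r n).1, SpecChain (∑ i, n i) z z'
  | 0, _ => ⟨(⊥ : PrimeSpectrum ℂ), _, .refl _⟩
  | r + 1, n => by
    obtain ⟨x, x', hx⟩ := ProjSpace.exists_specChain (n 0)
    obtain ⟨y, y', hy⟩ := exists_specChain_multiProj r (n ∘ Fin.succ)
    obtain ⟨z, z', h, -⟩ := exists_specChain_multiProj_succ n hx hy
    exact ⟨z, z', by simpa [Fin.sum_univ_succ] using h⟩

theorem exists_multiProj_proj (r : ℕ) (n : Fin r → ℕ) (i : Fin r) :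
    ∃ π : (multiProj r n).1 ⟶ ProjSpace (n i), ∀ {p : ℕ} {x x' : ProjSpace (n i)},
      SpecChain p x x' → ∃ (q : ℕ) (z z' : (multiProj r n).1),
        SpecChain q z z' ∧ π z = x ∧ q + n i = p + ∑ j, n j := by
  induction r with
  | zero => exact i.elim0
  | succ r ih =>
    cases i using Fin.cases with
    | zero =>
      refine ⟨Limits.pullback.fst _ _, fun {p x x'} hx ↦ ?_⟩
      obtain ⟨y, y', hy⟩ := exists_specChain_multiProj r (n ∘ Fin.succ)
      obtain ⟨z, z', h, hz, -⟩ := exists_specChain_multiProj_succ n hx hy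
      refine ⟨_, z, z', h, hz, ?_⟩
      simp only [Fin.sum_univ_succ, Function.comp_apply]
      lia
    | succ i =>
      obtain ⟨π, hπ⟩ := ih (n ∘ Fin.succ) i
      refine ⟨Limits.pullback.snd _ _ ≫ π, fun {p x x'} hx ↦ ?_⟩
      obtain ⟨y, y', hy⟩ := ProjSpace.exists_specChain (n 0)
      obtain ⟨q, w, w', hw, hwx, hq⟩ := hπ hx
      obtain ⟨z, z', h, -, hz⟩ := exists_specChain_multiProj_succ n hy hw
      refine ⟨_, z, z', h, ?_, ?_⟩
      · rw [← hwx, ← hz]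
        rfl
      · simp only [Fin.sum_univ_succ, Function.comp_apply] at hq ⊢
        lia

/-- For all `n₁,…,n_r ≥ 1`, every morphism
`ℙ^{n₁} × ⋯ × ℙ^{n_r} ⟶ ℙ^s` over `ℂ` that is injective on points satisfies
`s ≥ 2(n₁ + ⋯ + n_r) − min{n₁,…,n_r}`. -/
theorem stmt11 (r : ℕ) (hr : 1 ≤ r) (n : Fin r → ℕ) (hn : ∀ i, 1 ≤ n i)
    (s : ℕ) (φ : (multiProj r n).1 ⟶ ProjSpace s)
    (hφ : φ ≫ ProjSpace.structMor s = (multiProj r n).2)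
    (hinj : Function.Injective φ.base) :
    2 * ∑ i, n i ≤ s + Finset.univ.inf' ⟨⟨0, hr⟩, Finset.mem_univ _⟩ n := by
  obtain ⟨i, -, hi⟩ := Finset.exists_mem_eq_inf' ⟨⟨0, hr⟩, Finset.mem_univ _⟩ n
  rw [hi]
  have hpos := hn i
  obtain ⟨π, hπ⟩ := exists_multiProj_proj r n i
  have hpt : ∃ j, j ∉ Finset.univ.erase (0 : Fin (n i + 1)) := ⟨0, by simp⟩
  have hhyp : ∃ j, j ∉ ({0} : Finset (Fin (n i + 1))) :=
    ⟨Fin.last _, by simp [Fin.ext_iff]; lia⟩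
  obtain ⟨y', hy'⟩ := ProjSpace.exists_specChain_linearPt _ hhyp
  obtain ⟨p, x, x', hx, hxπ, hp⟩ := hπ (.refl (ProjSpace.linearPt _ hpt))
  obtain ⟨q, y, y', hy, hyπ, hq⟩ := hπ hy'
  have : IsProper φ := by
    have : IsProper (φ ≫ ProjSpace.structMor s) := hφ ▸ inferInstance
    exact IsProper.of_comp φ (ProjSpace.structMor s)
  have hmap ⦃u v : (multiProj r n).1⦄ (h : u ⤳ v) : φ u ⤳ φ v := h.map φ.continuous
  have key := ProjSpace.add_lt_of_disjoint (hx.map hmap hinj) (hy.map hmap hinj) fun w hxw hyw ↦ by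
    have hφc : SpecializingMap φ := φ.isClosedMap.specializingMap
    obtain ⟨u, hxu, rfl⟩ := hφc hxw
    obtain ⟨v, hyv, hvu⟩ := hφc hyw
    obtain rfl : v = u := hinj hvu
    have h₁ := hxu.map π.continuous
    have h₂ := hyv.map π.continuous
    rw [hxπ, ProjSpace.linearPt_specializes_iff] at h₁
    rw [hyπ, ProjSpace.linearPt_specializes_iff] at h₂
    refine ProjectiveSpectrum.not_irrelevant_le (show ProjectiveSpectrum
      (homogeneousSubmodule (Fin (n i + 1)) ℂ) from π v) (ProjSpace.irrelevant_le_iff.mpr fun j ↦ ?_)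
    by_cases hj : j = 0
    · exact h₂ j (by simp [hj])
    · exact h₁ j (by simp [hj])
  rw [Finset.card_singleton] at hq
  lia
end
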